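/- Let L be a finite-dimensional solvable left Leibniz algebra over F (F = ℝ or ℂ) that is not a Lie algebra, and suppose the nilradical of L (its unique maximal nilpotent ideal) is one-dimensional. Then dim L = 2 and there exist a basis {a,b} of L and a nonzero scalar c ∈ F such that [a,a] = 0, [a,b] = 0, [b,a] = c·a, and [b,b] = a. -/

import Mathlib

section Leibniz

variable {F : Type} [RCLike F] {L : Type} [AddCommGroup L] [Module F L]

/-- The span of all brackets `[x,y]` with `x ∈ I`, `y ∈ J`. -/
def bracketSpan (br : L →ₗ[F] L →ₗ[F] L) (I J : Submodule F L) : Submodule F L :=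
  Submodule.span F {z | ∃ x ∈ I, ∃ y ∈ J, z = br x y}

/-- The derived series `L^{(0)} = L`, `L^{(k+1)} = [L^{(k)}, L^{(k)}]`. -/
def leibDerivedSeries (br : L →ₗ[F] L →ₗ[F] L) : ℕ → Submodule F L
  | 0 => ⊤
  | k + 1 => bracketSpan br (leibDerivedSeries br k) (leibDerivedSeries br k)

/-- The lower central series of a subspace `I`: `I^1 = I`, `I^{k+1} = [I, I^k]`. -/
def leibLowerCentral (br : L →ₗ[F] L →ₗ[F] L) (I : Submodule F L) : ℕ → Submodule F L
  | 0 => I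
  | k + 1 => bracketSpan br I (leibLowerCentral br I k)

/-- `I` is a (two-sided) ideal of the Leibniz algebra. -/
def IsLeibnizIdeal (br : L →ₗ[F] L →ₗ[F] L) (I : Submodule F L) : Prop :=
  ∀ x y : L, y ∈ I → br x y ∈ I ∧ br y x ∈ I

/-- `I` is a nilpotent ideal of the Leibniz algebra. -/
def IsNilpotentIdeal (br : L →ₗ[F] L →ₗ[F] L) (I : Submodule F L) : Prop :=
  IsLeibnizIdeal br I ∧ ∃ k : ℕ, leibLowerCentral br I k = ⊥

end Leibniz

section LeibnizLemmas

variable {F : Type} [RCLike F] {L : Type} [AddCommGroup L] [Module F L]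

theorem bracketSpan_le {br : L →ₗ[F] L →ₗ[F] L} {I J P : Submodule F L}
    (h : ∀ x ∈ I, ∀ y ∈ J, br x y ∈ P) : bracketSpan br I J ≤ P := by
  refine Submodule.span_le.2 ?_
  rintro _ ⟨x, hx, y, hy, rfl⟩
  exact h x hx y hy

theorem br_mem_bracketSpan {br : L →ₗ[F] L →ₗ[F] L} {I J : Submodule F L} {x y : L}
    (hx : x ∈ I) (hy : y ∈ J) : br x y ∈ bracketSpan br I J :=
  Submodule.subset_span ⟨x, hx, y, hy, rfl⟩

theorem br_self_br_eq_zero {br : L →ₗ[F] L →ₗ[F] L}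
    (hleibniz : ∀ x y z : L, br x (br y z) = br (br x y) z + br y (br x z)) (x y : L) :
    br (br x x) y = 0 := by
  simpa using hleibniz x x y

theorem IsLeibnizIdeal.bracketSpan_self {br : L →ₗ[F] L →ₗ[F] L}
    (hleibniz : ∀ x y z : L, br x (br y z) = br (br x y) z + br y (br x z))
    {I : Submodule F L} (hI : IsLeibnizIdeal br I) : IsLeibnizIdeal br (bracketSpan br I I) := by
  intro x y hy
  constructor
  · suffices h : bracketSpan br I I ≤ (bracketSpan br I I).comap (br x) from h hy
    refine bracketSpan_le fun u hu v hv => ?_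
    rw [Submodule.mem_comap, hleibniz]
    exact add_mem (br_mem_bracketSpan (hI x u hu).1 hv) (br_mem_bracketSpan hu (hI x v hv).1)
  · suffices h : bracketSpan br I I ≤ (bracketSpan br I I).comap (br.flip x) from h hy
    refine bracketSpan_le fun u hu v hv => ?_
    rw [Submodule.mem_comap, LinearMap.flip_apply, ← sub_eq_of_eq_add (hleibniz u v x)]
    exact sub_mem (br_mem_bracketSpan hu (hI x v hv).2) (br_mem_bracketSpan hv (hI x u hu).2)

theorem isLeibnizIdeal_leibDerivedSeries {br : L →ₗ[F] L →ₗ[F] L}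
    (hleibniz : ∀ x y z : L, br x (br y z) = br (br x y) z + br y (br x z)) (k : ℕ) :
    IsLeibnizIdeal br (leibDerivedSeries br k) := by
  induction k with
  | zero => exact fun _ _ _ => ⟨Submodule.mem_top, Submodule.mem_top⟩
  | succ k ih => exact ih.bracketSpan_self hleibniz

theorem IsLeibnizIdeal.inf {br : L →ₗ[F] L →ₗ[F] L} {I J : Submodule F L}
    (hI : IsLeibnizIdeal br I) (hJ : IsLeibnizIdeal br J) : IsLeibnizIdeal br (I ⊓ J) :=
  fun x y hy => ⟨⟨(hI x y hy.1).1, (hJ x y hy.2).1⟩, ⟨(hI x y hy.1).2, (hJ x y hy.2).2⟩⟩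

/-- The span of the squares is an abelian ideal. -/
theorem isNilpotentIdeal_span_squares {br : L →ₗ[F] L →ₗ[F] L}
    (hleibniz : ∀ x y z : L, br x (br y z) = br (br x y) z + br y (br x z)) :
    IsNilpotentIdeal br (Submodule.span F (Set.range fun x => br x x)) := by
  set S := Submodule.span F (Set.range fun x => br x x)
  have sq (x : L) : br x x ∈ S := Submodule.subset_span ⟨x, rfl⟩
  have left_zero {s : L} (hs : s ∈ S) (x : L) : br s x = 0 := by
    suffices h : S ≤ LinearMap.ker (br.flip x) from h hs
    refine Submodule.span_le.2 ?_
    rintro _ ⟨y, rfl⟩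
    exact br_self_br_eq_zero hleibniz y x
  refine ⟨fun x s hs => ⟨?_, ?_⟩, 1, ?_⟩
  · suffices h : S ≤ S.comap (br x) from h hs
    refine Submodule.span_le.2 ?_
    rintro _ ⟨y, rfl⟩
    have key : br x (br y y)
        = br (br x y + y) (br x y + y) - br (br x y) (br x y) - br y y := by
      rw [hleibniz]
      simp only [map_add, LinearMap.add_apply]
      abel
    change br x (br y y) ∈ S
    rw [key]
    exact sub_mem (sub_mem (sq _) (sq _)) (sq _)
  · rw [left_zero hs]
    exact zero_mem _
  · refine le_bot_iff.1 (bracketSpan_le fun s hs y _ => ?_)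
    rw [left_zero hs]
    exact zero_mem _

theorem exists_br_self_ne_zero {br : L →ₗ[F] L →ₗ[F] L}
    (h : ¬ ∀ x y : L, br x y = - br y x) : ∃ x, br x x ≠ 0 := by
  by_contra! h0
  refine h fun x y => eq_neg_of_add_eq_zero_left ?_
  simpa [h0] using h0 (x + y)

/-- An ideal of a solvable Leibniz algebra annihilating the nilradical from the left is contained
in the nilradical. -/
theorem IsLeibnizIdeal.le_of_br_eq_zero {br : L →ₗ[F] L →ₗ[F] L}
    (hleibniz : ∀ x y z : L, br x (br y z) = br (br x y) z + br y (br x z))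
    (hsolv : ∃ k : ℕ, leibDerivedSeries br k = ⊥) {N K : Submodule F L}
    (hNmax : ∀ I : Submodule F L, IsNilpotentIdeal br I → I ≤ N)
    (hK : IsLeibnizIdeal br K) (hKN : ∀ x ∈ K, ∀ y ∈ N, br x y = 0) : K ≤ N := by
  obtain ⟨k, hk⟩ := hsolv
  have base : K ⊓ leibDerivedSeries br k ≤ N := by simp [hk]
  clear hk
  induction k with
  | zero => simpa [leibDerivedSeries] using base
  | succ k ih =>
    refine ih (hNmax _ ⟨hK.inf (isLeibnizIdeal_leibDerivedSeries hleibniz k), 2, ?_⟩)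
    have h1 : leibLowerCentral br (K ⊓ leibDerivedSeries br k) 1 ≤ N :=
      bracketSpan_le fun x hx y hy =>
        base ⟨(hK x y hy.1).1, br_mem_bracketSpan hx.2 hy.2⟩
    exact le_bot_iff.1 (bracketSpan_le fun x hx y hy => hKN x hx.1 y (h1 hy))

end LeibnizLemmas

/-- A finite-dimensional solvable left Leibniz algebra over `F` (`ℝ` or
`ℂ`) that is not a Lie algebra and whose nilradical (the unique maximal nilpotent
ideal `N`) is one-dimensional has dimension 2, with a basis `{a, b}` and a nonzero
scalar `c` such that `[a,a] = 0`, `[a,b] = 0`, `[b,a] = c•a`, `[b,b] = a`. -/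
theorem stmt_18 {F : Type} [RCLike F] {L : Type} [AddCommGroup L] [Module F L]
    [FiniteDimensional F L]
    (br : L →ₗ[F] L →ₗ[F] L)
    (hleibniz : ∀ x y z : L, br x (br y z) = br (br x y) z + br y (br x z))
    (hsolv : ∃ k : ℕ, leibDerivedSeries br k = ⊥)
    (hnotlie : ¬ ∀ x y : L, br x y = - br y x)
    (N : Submodule F L)
    (hN : IsNilpotentIdeal br N)
    (hNmax : ∀ I : Submodule F L, IsNilpotentIdeal br I → I ≤ N)
    (hNdim : Module.finrank F N = 1) :
    Module.finrank F L = 2 ∧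
    ∃ a b : L, LinearIndependent F ![a, b] ∧ Submodule.span F {a, b} = ⊤ ∧
      ∃ c : F, c ≠ 0 ∧ br a a = 0 ∧ br a b = 0 ∧ br b a = c • a ∧ br b b = a := by
  obtain ⟨x₀, hx₀⟩ := exists_br_self_ne_zero hnotlie
  have sq (x : L) : br x x ∈ N :=
    hNmax _ (isNilpotentIdeal_span_squares hleibniz) (Submodule.subset_span ⟨x, rfl⟩)
  set a := br x₀ x₀ with ha
  have haN : a ∈ N := sq x₀
  have ha0 (y : L) : br a y = 0 := br_self_br_eq_zero hleibniz x₀ y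
  have hspan (y : L) (hy : y ∈ N) : ∃ c : F, c • a = y := by
    obtain ⟨c, hc⟩ := (finrank_eq_one_iff_of_nonzero' (⟨a, haN⟩ : N)
      (by simpa [Subtype.ext_iff] using hx₀)).1 hNdim ⟨y, hy⟩
    exact ⟨c, congrArg Subtype.val hc⟩
  have hact (x : L) : ∃ c : F, c • a = br x a := hspan _ (hN.1 x a haN).1
  have hK : IsLeibnizIdeal br (LinearMap.ker (br.flip a)) := by
    intro x y hy
    simp only [LinearMap.mem_ker, LinearMap.flip_apply] at hy ⊢
    obtain ⟨c, hc⟩ := hact x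
    have h1 := hleibniz x y a
    have h2 := hleibniz y x a
    rw [← hc, hy, map_smul, hy] at h1 h2
    simp only [map_zero, smul_zero, add_zero] at h1 h2
    exact ⟨h1.symm, h2.symm⟩
  have hKN : LinearMap.ker (br.flip a) ≤ N := by
    refine hK.le_of_br_eq_zero hleibniz hsolv hNmax fun x hx y hy => ?_
    obtain ⟨c, rfl⟩ := hspan y hy
    rw [map_smul, show br x a = 0 from hx, smul_zero]
  have hNK : LinearMap.ker (br.flip a) = N := by
    refine le_antisymm hKN fun y hy => ?_
    obtain ⟨c, rfl⟩ := hspan y hy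
    simp [ha0]
  obtain ⟨b, hb⟩ : ∃ b, br b a ≠ 0 := by
    by_contra! h
    obtain ⟨c, hc⟩ := hspan x₀ (hKN (h x₀))
    apply hx₀
    rw [ha, ← hc]
    simp [ha0]
  obtain ⟨c, hc⟩ := hact b
  have hc0 : c ≠ 0 := by
    rintro rfl
    exact hb (by rw [← hc, zero_smul])
  obtain ⟨γ, hγ⟩ := hspan _ (sq b)
  have hbN : b + ((1 - γ) / c) • a ∉ N := by
    rw [← hNK]
    simpa [ha0] using hb
  set b' := b + ((1 - γ) / c) • a with hb'
  have hb'a : br b' a = c • a := by simp [hb', ha0, hc]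
  have hb'b' : br b' b' = a := by
    simp only [hb', map_add, map_smul, LinearMap.add_apply, LinearMap.smul_apply, ha0, ← hc, ← hγ,
      smul_zero, add_zero, smul_smul, ← add_smul]
    rw [div_mul_cancel₀ _ hc0, add_sub_cancel, one_smul]
  have hli : LinearIndependent F ![a, b'] := by
    rw [LinearIndependent.pair_iff' hx₀]
    exact fun t ht => hbN (ht ▸ N.smul_mem t haN)
  have hsp : Submodule.span F {a, b'} = ⊤ := by
    refine eq_top_iff.2 fun x _ => ?_
    obtain ⟨d, hd⟩ := hact x
    have hmem : x - (d / c) • b' ∈ N := by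
      rw [← hNK, LinearMap.mem_ker, LinearMap.flip_apply, map_sub, map_smul, LinearMap.sub_apply,
        LinearMap.smul_apply, hb'a, ← hd, smul_smul, div_mul_cancel₀ _ hc0, sub_self]
    obtain ⟨e, he⟩ := hspan _ hmem
    exact Submodule.mem_span_pair.2 ⟨e, d / c, by rw [he, sub_add_cancel]⟩
  refine ⟨?_, a, b', hli, hsp, c, hc0, ha0 a, ha0 b', hb'a, hb'b'⟩
  have h := finrank_span_eq_card hli
  rwa [Matrix.range_cons_cons_empty, hsp, finrank_top, Fintype.card_fin] at h
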